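/- arXiv:2110.14376 — 8 statements merged into one kernel-verified Lean document; each statement's English description precedes it below -/
import Mathlib

section
/- Suppose X ∈ E with X ≠ 0 satisfies g(X) = X. Then ‖A b + c‖ ≤ ‖X‖ + 3/‖X‖. -/
open scoped RealInnerProductSpace

lemma norm_inv_norm_sq_smul_self {E : Type*} [NormedAddCommGroup E] [NormedSpace ℝ E]
    {w : E} (hw : w ≠ 0) : ‖(‖w‖ ^ 2)⁻¹ • w‖ = 1 / ‖w‖ := by
  have hw' : ‖w‖ ≠ 0 := norm_ne_zero_iff.mpr hw
  rw [norm_smul, norm_inv, norm_pow, norm_norm]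
  field_simp

lemma norm_two_mul_inner_div_smul_le {E : Type*} [NormedAddCommGroup E] [InnerProductSpace ℝ E]
    {w b : E} (hw : w ≠ 0) (hb : b ≠ 0) :
    ‖(2 * ⟪w, b⟫ / (‖w‖ ^ 2 * ‖b‖ ^ 2)) • b‖ ≤ 2 / ‖w‖ := by
  have hw' : 0 < ‖w‖ := norm_pos_iff.mpr hw
  have hb' : 0 < ‖b‖ := norm_pos_iff.mpr hb
  rw [norm_smul, norm_div, norm_mul, norm_mul, norm_pow, norm_pow, norm_norm, norm_norm,
    Real.norm_ofNat]
  calc 2 * ‖⟪w, b⟫‖ / (‖w‖ ^ 2 * ‖b‖ ^ 2) * ‖b‖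
      ≤ 2 * (‖w‖ * ‖b‖) / (‖w‖ ^ 2 * ‖b‖ ^ 2) * ‖b‖ := by
        gcongr
        exact norm_inner_le_norm w b
    _ = 2 / ‖w‖ := by field_simp

/-- Inequality (1) in the proof of Lemma 2.1: if `X ≠ 0` is a fixed point of the
boundary Möbius map `g(X) = A(V X/‖V X‖² − (2⟪V X, b⟫/(‖V X‖²‖b‖²)) • b + b) + c`,
then `‖A b + c‖ ≤ ‖X‖ + 3/‖X‖`. -/
theorem stmt_0 {n : ℕ} (hn : 2 ≤ n)
    (A V : EuclideanSpace ℝ (Fin n) ≃ₗᵢ[ℝ] EuclideanSpace ℝ (Fin n))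
    (b c : EuclideanSpace ℝ (Fin n)) (hb : b ≠ 0)
    (X : EuclideanSpace ℝ (Fin n)) (hX : X ≠ 0)
    (hfix : A ((‖V X‖ ^ 2)⁻¹ • V X
        - (2 * ⟪V X, b⟫ / (‖V X‖ ^ 2 * ‖b‖ ^ 2)) • b + b) + c = X) :
    ‖A b + c‖ ≤ ‖X‖ + 3 / ‖X‖ := by
  have hVX : V X ≠ 0 := by simpa using hX
  set u := (‖V X‖ ^ 2)⁻¹ • V X - (2 * ⟪V X, b⟫ / (‖V X‖ ^ 2 * ‖b‖ ^ 2)) • b with hu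
  have hAu : A b + c = X - A u := by
    rw [map_add] at hfix
    rw [← hfix]
    abel
  have hu_norm : ‖u‖ ≤ 1 / ‖X‖ + 2 / ‖X‖ := by
    rw [← V.norm_map X]
    exact (norm_sub_le _ _).trans (add_le_add (norm_inv_norm_sq_smul_self hVX).le
      (norm_two_mul_inner_div_smul_le hVX hb))
  calc ‖A b + c‖ ≤ ‖X‖ + ‖A u‖ := hAu ▸ norm_sub_le X (A u)
    _ ≤ ‖X‖ + (1 / ‖X‖ + 2 / ‖X‖) := by rw [A.norm_map]; gcongr
    _ = ‖X‖ + 3 / ‖X‖ := by ring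
end

section
/- Suppose X ∈ E with X ≠ 0 satisfies g(X) = X. Then ‖X − (A b + c)‖ ≤ 3/‖X‖. -/
open scoped RealInnerProductSpace

/-- The inversion of `w` in the unit sphere, reflected in the hyperplane orthogonal to `b`,
has norm at most `3 / ‖w‖`. -/
theorem norm_inversion_sub_reflection_le {E : Type*} [NormedAddCommGroup E]
    [InnerProductSpace ℝ E] {w b : E} (hw : w ≠ 0) (hb : b ≠ 0) :
    ‖(‖w‖ ^ 2)⁻¹ • w - (2 * ⟪w, b⟫ / (‖w‖ ^ 2 * ‖b‖ ^ 2)) • b‖ ≤ 3 / ‖w‖ := by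
  have hw' : 0 < ‖w‖ := norm_pos_iff.mpr hw
  have hb' : 0 < ‖b‖ := norm_pos_iff.mpr hb
  calc
    _ ≤ ‖(‖w‖ ^ 2)⁻¹ • w‖ + ‖(2 * ⟪w, b⟫ / (‖w‖ ^ 2 * ‖b‖ ^ 2)) • b‖ := norm_sub_le _ _
    _ = (‖w‖ ^ 2)⁻¹ * ‖w‖ + 2 * |⟪w, b⟫| / (‖w‖ ^ 2 * ‖b‖ ^ 2) * ‖b‖ := by
      simp [norm_smul]
    _ ≤ (‖w‖ ^ 2)⁻¹ * ‖w‖ + 2 * (‖w‖ * ‖b‖) / (‖w‖ ^ 2 * ‖b‖ ^ 2) * ‖b‖ := by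
      gcongr
      exact abs_real_inner_le_norm w b
    _ = 3 / ‖w‖ := by
      field_simp
      norm_num

/-- Inequality (2) in the proof of Lemma 2.1: if `X ≠ 0` is a fixed point of the
boundary Möbius map `g(X) = A(V X/‖V X‖² − (2⟪V X, b⟫/(‖V X‖²‖b‖²)) • b + b) + c`,
then `‖X − (A b + c)‖ ≤ 3/‖X‖`. -/
theorem stmt_1 {n : ℕ} (hn : 2 ≤ n)
    (A V : EuclideanSpace ℝ (Fin n) ≃ₗᵢ[ℝ] EuclideanSpace ℝ (Fin n))
    (b c : EuclideanSpace ℝ (Fin n)) (hb : b ≠ 0)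
    (X : EuclideanSpace ℝ (Fin n)) (hX : X ≠ 0)
    (hfix : A ((‖V X‖ ^ 2)⁻¹ • V X
        - (2 * ⟪V X, b⟫ / (‖V X‖ ^ 2 * ‖b‖ ^ 2)) • b + b) + c = X) :
    ‖X - (A b + c)‖ ≤ 3 / ‖X‖ := by
  have hVX : V X ≠ 0 := by simpa using hX
  calc
    ‖X - (A b + c)‖
      = ‖A ((‖V X‖ ^ 2)⁻¹ • V X - (2 * ⟪V X, b⟫ / (‖V X‖ ^ 2 * ‖b‖ ^ 2)) • b)‖ := by
      rw [map_add, add_assoc] at hfix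
      rw [eq_sub_of_add_eq hfix]
    _ ≤ 3 / ‖V X‖ := by
      rw [A.norm_map]
      exact norm_inversion_sub_reflection_le hVX hb
    _ = 3 / ‖X‖ := by rw [V.norm_map]
end

section
/- Suppose X ∈ E with X ≠ 0 satisfies g(X) = X, and set R = ‖A b + c‖. If R > 0, then ‖X‖ ≤ 6/R or ‖X − (A b + c)‖ ≤ 6/R; that is, every fixed point of g lies either within 6/R of the origin or within 6/R of the point A b + c. -/
open scoped RealInnerProductSpace

/-- Reflecting in the hyperplane orthogonal to `b` preserves the norm. -/
theorem norm_sub_two_mul_inner_div_smul {F : Type*} [NormedAddCommGroup F]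
    [InnerProductSpace ℝ F] (y : F) {b : F} (hb : b ≠ 0) :
    ‖y - (2 * ⟪y, b⟫ / ‖b‖ ^ 2) • b‖ = ‖y‖ := by
  have hb' : ‖b‖ ≠ 0 := norm_ne_zero_iff.mpr hb
  rw [← sq_eq_sq₀ (norm_nonneg _) (norm_nonneg _), norm_sub_sq_real, inner_smul_right,
    norm_smul, mul_pow, Real.norm_eq_abs, sq_abs]
  field_simp
  ring

/-- The quantitative dichotomy underlying Lemma 2.1: every nonzero fixed point `X` of
the boundary Möbius map `g` lies either within `6/R` of the origin or within `6/R` of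
the point `A b + c`, where `R = ‖A b + c‖ > 0`. -/
theorem stmt_2 {n : ℕ} (hn : 2 ≤ n)
    (A V : EuclideanSpace ℝ (Fin n) ≃ₗᵢ[ℝ] EuclideanSpace ℝ (Fin n))
    (b c : EuclideanSpace ℝ (Fin n)) (hb : b ≠ 0)
    (X : EuclideanSpace ℝ (Fin n)) (hX : X ≠ 0)
    (hfix : A ((‖V X‖ ^ 2)⁻¹ • V X
        - (2 * ⟪V X, b⟫ / (‖V X‖ ^ 2 * ‖b‖ ^ 2)) • b + b) + c = X)
    (R : ℝ) (hR : R = ‖A b + c‖) (hRpos : 0 < R) :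
    ‖X‖ ≤ 6 / R ∨ ‖X - (A b + c)‖ ≤ 6 / R := by
  have hx : 0 < ‖X‖ := norm_pos_iff.mpr hX
  have hdist : ‖X - (A b + c)‖ = 1 / ‖X‖ := by
    have hsub : X - (A b + c) =
        A ((‖V X‖ ^ 2)⁻¹ • (V X - (2 * ⟪V X, b⟫ / ‖b‖ ^ 2) • b)) := by
      have hcoef : 2 * ⟪V X, b⟫ / (‖V X‖ ^ 2 * ‖b‖ ^ 2) =
          (‖V X‖ ^ 2)⁻¹ * (2 * ⟪V X, b⟫ / ‖b‖ ^ 2) := by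
        rw [inv_mul_eq_div, div_div, mul_comm (‖b‖ ^ 2)]
      rw [hcoef, map_add, add_assoc] at hfix
      rw [smul_sub, smul_smul]
      exact (eq_sub_of_add_eq hfix).symm
    rw [hsub, A.norm_map, norm_smul, norm_sub_two_mul_inner_div_smul _ hb, V.norm_map,
      Real.norm_of_nonneg (by positivity)]
    field_simp
  have htri : R ≤ ‖X‖ + 1 / ‖X‖ := by
    rw [hR, ← hdist]
    exact norm_le_insert X (A b + c)
  rw [hdist]
  rcases le_total R (6 * ‖X‖) with h | h
  · right
    rw [div_le_div_iff₀ hx hRpos]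
    linarith
  · left
    rw [le_div_iff₀ hRpos]
    have hmul : R * ‖X‖ ≤ ‖X‖ * ‖X‖ + 1 := by
      calc R * ‖X‖ ≤ (‖X‖ + 1 / ‖X‖) * ‖X‖ := by gcongr
        _ = ‖X‖ * ‖X‖ + 1 := by field_simp
    nlinarith
end

section
/- For every ε > 0 there exists R₀ > 0 such that whenever ‖A b + c‖ ≥ R₀, every X ∈ E with X ≠ 0 and g(X) = X satisfies ‖X‖ ≤ ε or ‖X − (A b + c)‖ ≤ ε. -/
open scoped RealInnerProductSpace

/-- Inversion in the unit sphere followed by reflection in `bᗮ` sends `Y` to a vector of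
norm `‖Y‖⁻¹`. -/
theorem norm_reflection_inversion {E : Type*} [NormedAddCommGroup E] [InnerProductSpace ℝ E]
    {Y b : E} (hY : Y ≠ 0) (hb : b ≠ 0) :
    ‖(‖Y‖ ^ 2)⁻¹ • Y - (2 * ⟪Y, b⟫ / (‖Y‖ ^ 2 * ‖b‖ ^ 2)) • b‖ = ‖Y‖⁻¹ := by
  have hY' : ‖Y‖ ≠ 0 := norm_ne_zero_iff.mpr hY
  have hb' : ‖b‖ ≠ 0 := norm_ne_zero_iff.mpr hb
  rw [← sq_eq_sq₀ (norm_nonneg _) (by positivity), norm_sub_sq_real, norm_smul, norm_smul,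
    mul_pow, mul_pow, Real.norm_eq_abs, Real.norm_eq_abs, sq_abs, sq_abs,
    real_inner_smul_left, real_inner_smul_right]
  field_simp
  ring

/-- Lemma 2.1 of the paper expressed on the boundary: for every `ε > 0` there is
`R₀ > 0` such that whenever `‖A b + c‖ ≥ R₀` (that is, `‖t‖` is large, where
`t(X) = A X + c`), every nonzero fixed point `X` of the boundary Möbius map
`g = t ∘ h₂ ∘ h₁ ∘ V` lies within `ε` of the origin `A₀` or within `ε` of
`B_t = A b + c`. -/
theorem stmt_3 {n : ℕ} (hn : 2 ≤ n)
    (V : EuclideanSpace ℝ (Fin n) ≃ₗᵢ[ℝ] EuclideanSpace ℝ (Fin n))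
    (b : EuclideanSpace ℝ (Fin n)) (hb : b ≠ 0)
    (ε : ℝ) (hε : 0 < ε) :
    ∃ R₀ > (0 : ℝ),
      ∀ (A : EuclideanSpace ℝ (Fin n) ≃ₗᵢ[ℝ] EuclideanSpace ℝ (Fin n))
        (c : EuclideanSpace ℝ (Fin n)), ‖A b + c‖ ≥ R₀ →
        ∀ X : EuclideanSpace ℝ (Fin n), X ≠ 0 →
          A ((‖V X‖ ^ 2)⁻¹ • V X
            - (2 * ⟪V X, b⟫ / (‖V X‖ ^ 2 * ‖b‖ ^ 2)) • b + b) + c = X →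
          ‖X‖ ≤ ε ∨ ‖X - (A b + c)‖ ≤ ε := by
  refine ⟨2 / ε, by positivity, fun A c hR X hX hfix => ?_⟩
  refine or_iff_not_imp_left.mpr fun hXε => ?_
  rw [not_le] at hXε
  have hdist : ‖X - (A b + c)‖ = ‖X‖⁻¹ := by
    have h := norm_reflection_inversion (Y := V X) (V.map_ne_zero_iff.mpr hX) hb
    rw [← A.norm_map, V.norm_map X] at h
    rw [← h]
    congr 1
    nth_rw 1 [← hfix]
    rw [map_add, V.norm_map X]
    abel
  have hinv : ‖X‖⁻¹ ≤ ε⁻¹ := inv_anti₀ hε hXε.le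
  have htri : ‖A b + c‖ ≤ ‖X‖ + ‖X - (A b + c)‖ := by
    simpa using norm_sub_le X (X - (A b + c))
  have hlarge : ε⁻¹ ≤ ‖X‖ := by
    rw [div_eq_mul_inv] at hR
    linarith
  rw [hdist]
  exact inv_le_of_inv_le₀ hε hlarge
end

section
/- For every X ∈ E with X ≠ 0 and ‖X − (1/2)•u‖ ≤ 1/2, the point h(X) = h₂(h₁(X)) satisfies ⟪h(X), u⟫ ≥ 1; moreover h(u) = u + b. That is, h maps the horoball H₀ (minus its boundary tangency point 0) into the horoball H_∞ and sends A₀ = u to B₀ = u + b. -/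
open scoped RealInnerProductSpace

/-- The construction `h = h₂ ∘ h₁` in the proof of Lemma 2.1: `h` maps the horoball
`H₀` (minus its tangency point `0`) into the horoball `H_∞ = {X : ⟪X, u⟫ ≥ 1}`,
and sends `A₀ = u` to `B₀ = u + b`. Here `h₁(X) = X/‖X‖²` and
`h₂(Y) = Y − (2⟪Y, b⟫/‖b‖²)•b + b`. -/
theorem stmt_6 {n : ℕ} (hn : 2 ≤ n)
    (u b : EuclideanSpace ℝ (Fin n)) (hu : ‖u‖ = 1) (hb : b ≠ 0)
    (hbu : ⟪b, u⟫ = 0)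
    (h₁ h₂ : EuclideanSpace ℝ (Fin n) → EuclideanSpace ℝ (Fin n))
    (hh₁ : ∀ X, h₁ X = (‖X‖ ^ 2)⁻¹ • X)
    (hh₂ : ∀ Y, h₂ Y = Y - (2 * ⟪Y, b⟫ / ‖b‖ ^ 2) • b + b) :
    (∀ X : EuclideanSpace ℝ (Fin n), X ≠ 0 →
      ‖X - (1 / 2 : ℝ) • u‖ ≤ 1 / 2 → ⟪h₂ (h₁ X), u⟫ ≥ 1) ∧
    h₂ (h₁ u) = u + b := by
  refine ⟨fun X hX hball => ?_, ?_⟩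
  · have hpos : 0 < ‖X‖ ^ 2 := by positivity
    have hsq : ‖X‖ ^ 2 ≤ ⟪X, u⟫ := by
      have hle : ‖X - (1 / 2 : ℝ) • u‖ ^ 2 ≤ (1 / 2) ^ 2 :=
        pow_le_pow_left₀ (norm_nonneg _) hball 2
      rw [norm_sub_sq_real, inner_smul_right, norm_smul, hu] at hle
      norm_num at hle
      linarith
    rw [hh₂, inner_add_left, inner_sub_left, inner_smul_left, hbu, hh₁, inner_smul_left]
    simp only [mul_zero, sub_zero, add_zero, conj_trivial]
    rw [ge_iff_le, inv_mul_eq_div, one_le_div hpos]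
    exact hsq
  · have hub : ⟪u, b⟫ = 0 := by rw [real_inner_comm, hbu]
    simp [hh₁, hh₂, hu, hub]
end

section
/- Every element w of the subgroup of Equiv.Perm (ℝ × ℝ) generated by s and t can be written as w = s^n * t^m for some integers n and m. -/
/-- If `t * s * t = s`, then every element of the subgroup generated by `s` and `t` has the form
`s ^ n * t ^ m`. -/
theorem exists_eq_zpow_mul_zpow_of_mem_closure_pair {G : Type*} [Group G] {s t w : G}
    (h : t * s * t = s) (hw : w ∈ Subgroup.closure ({s, t} : Set G)) :
    ∃ n m : ℤ, w = s ^ n * t ^ m := by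
  have hst : SemiconjBy s t⁻¹ t := by
    rw [SemiconjBy, mul_inv_eq_iff_eq_mul, h]
  have hs (m : ℤ) : t ^ m * s = s * t ^ (-m) := by
    simpa using (hst.zpow_right m).eq.symm
  have hs' (m : ℤ) : t ^ m * s⁻¹ = s⁻¹ * t ^ (-m) := by
    rw [mul_inv_eq_iff_eq_mul, mul_assoc, hs, neg_neg, inv_mul_cancel_left]
  induction hw using Subgroup.closure_induction_right with
  | one => exact ⟨0, 0, by simp⟩
  | mul_right x hx y hy ih =>
    obtain ⟨n, m, rfl⟩ := ih
    rcases hy with rfl | rfl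
    · exact ⟨n + 1, -m, by rw [mul_assoc, hs, zpow_add_one, mul_assoc]⟩
    · exact ⟨n, m + 1, by rw [mul_assoc, zpow_add_one]⟩
  | mul_inv_cancel x hx y hy ih =>
    obtain ⟨n, m, rfl⟩ := ih
    rcases hy with rfl | rfl
    · exact ⟨n - 1, -m, by rw [mul_assoc, hs', zpow_sub_one, mul_assoc]⟩
    · exact ⟨n, m - 1, by rw [mul_assoc, zpow_sub_one]⟩


/-- Normal form in `Γ_∞` (Section 4): every element of the subgroup of
`Equiv.Perm (ℝ × ℝ)` generated by the glide reflection `s(x, y) = (x + α, −y)` and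
the translation `t(x, y) = (x, y + β)` can be written as `s^n * t^m`. -/
theorem stmt_11 (α β : ℝ)
    (s t : Equiv.Perm (ℝ × ℝ))
    (hs : ∀ p : ℝ × ℝ, s p = (p.1 + α, -p.2))
    (ht : ∀ p : ℝ × ℝ, t p = (p.1, p.2 + β)) :
    ∀ w ∈ Subgroup.closure ({s, t} : Set (Equiv.Perm (ℝ × ℝ))),
      ∃ n m : ℤ, w = s ^ n * t ^ m := by
  intro w hw
  refine exists_eq_zpow_mul_zpow_of_mem_closure_pair (Equiv.ext fun p => ?_) hw
  simp [hs, ht]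
end

section
/- Assume α > 0 and β > 0. For all integers n and m with (n, m) ≠ (0, 0), the map s^n * t^m has no fixed point in ℝ × ℝ; in other words, the group generated by s and t acts freely on the plane. -/
/-- If a permutation shifts a real-valued function by `c`, then its `n`-th power shifts it
by `n * c`. -/
theorem Equiv.Perm.zpow_apply_eq_add_mul {X : Type*} (f : X → ℝ) (g : Equiv.Perm X) (c : ℝ)
    (h : ∀ x, f (g x) = f x + c) (n : ℤ) (x : X) : f ((g ^ n) x) = f x + n * c := by
  induction n generalizing x with
  | zero => simp
  | succ k ih =>
    rw [zpow_add_one, Equiv.Perm.mul_apply, ih, h]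
    push_cast
    ring
  | pred k ih =>
    have hinv : f (g⁻¹ x) = f x - c := by
      have := h (g⁻¹ x)
      rw [← Equiv.Perm.mul_apply, mul_inv_cancel, Equiv.Perm.one_apply] at this
      linarith
    rw [zpow_sub_one, Equiv.Perm.mul_apply, ih, hinv]
    push_cast
    ring

/-- Freeness of the `Γ_∞`-action (Section 4): if `α > 0` and `β > 0`, then for
`(n, m) ≠ (0, 0)` the element `s^n * t^m` has no fixed point in the plane, where
`s(x, y) = (x + α, −y)` and `t(x, y) = (x, y + β)`. -/
theorem stmt_12 (α β : ℝ) (hα : 0 < α) (hβ : 0 < β)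
    (s t : Equiv.Perm (ℝ × ℝ))
    (hs : ∀ p : ℝ × ℝ, s p = (p.1 + α, -p.2))
    (ht : ∀ p : ℝ × ℝ, t p = (p.1, p.2 + β)) :
    ∀ n m : ℤ, (n, m) ≠ ((0 : ℤ), (0 : ℤ)) →
      ∀ p : ℝ × ℝ, (s ^ n * t ^ m) p ≠ p := by
  intro n m hnm p hp
  have hfst : ((s ^ n * t ^ m) p).1 = p.1 + n * α := by
    rw [Equiv.Perm.mul_apply,
      Equiv.Perm.zpow_apply_eq_add_mul Prod.fst s α (fun q => by rw [hs]),
      Equiv.Perm.zpow_apply_eq_add_mul Prod.fst t 0 (fun q => by rw [ht, add_zero]),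
      mul_zero, add_zero]
  rw [hp, left_eq_add, mul_eq_zero, or_iff_left hα.ne', Int.cast_eq_zero] at hfst
  subst hfst
  have hsnd := Equiv.Perm.zpow_apply_eq_add_mul Prod.snd t β (fun q => by rw [ht]) m p
  rw [zpow_zero, one_mul] at hp
  rw [hp, left_eq_add, mul_eq_zero, or_iff_left hβ.ne', Int.cast_eq_zero] at hsnd
  exact hnm (by rw [hsnd])
end

section
/- Let d ≥ 2, let j : Fin d be an index with j ≠ 0, let b : Fin d → ℝ satisfy 0 ≤ b i for all i, and let ε > 0 satisfy b i + 2ε < 1 for all i and 2ε < b j. Let C, D : Fin d → ℝ satisfy |C i| ≤ ε and |D i − b i| ≤ ε for every index i ≠ 0. If M = C + σ • (D − C) and N = C + τ • (D − C) with σ, τ ∈ [0, 1], and if N i − M i is an integer for every index i, then M = N. -/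
/-- The combinatorial core of the proof of Theorem 3.1: in coordinates where the
parabolic lattice is `ℤ^d` acting by translations, with `A₀ = 0`, `B₀ = b`
(`0 ≤ b i`, `b i + 2ε < 1`, `b j > 2ε` for some `j ≠ 0`), and `C, D` close to `0`
and `b` respectively in all coordinates `i ≠ 0`, no two distinct points of the
segment from `C` to `D` differ by an integer vector. -/
theorem stmt_14 (d : ℕ) (hd : 2 ≤ d) (j : Fin d)
    (hj : j ≠ (⟨0, by omega⟩ : Fin d))
    (b : Fin d → ℝ) (hb : ∀ i, 0 ≤ b i)
    (ε : ℝ) (hε : 0 < ε)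
    (hbε : ∀ i, b i + 2 * ε < 1) (hbj : 2 * ε < b j)
    (C D : Fin d → ℝ)
    (hC : ∀ i : Fin d, i ≠ (⟨0, by omega⟩ : Fin d) → |C i| ≤ ε)
    (hD : ∀ i : Fin d, i ≠ (⟨0, by omega⟩ : Fin d) → |D i - b i| ≤ ε)
    (σ τ : ℝ) (hσ : σ ∈ Set.Icc (0 : ℝ) 1) (hτ : τ ∈ Set.Icc (0 : ℝ) 1)
    (M N : Fin d → ℝ)
    (hM : M = C + σ • (D - C)) (hN : N = C + τ • (D - C))
    (hint : ∀ i, ∃ z : ℤ, N i - M i = (z : ℝ)) :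
    M = N := by
  obtain ⟨z, hz⟩ := hint j
  have hCj := abs_le.mp (hC j hj)
  have hDj := abs_le.mp (hD j hj)
  have hpos : 0 < D j - C j := by linarith
  have hlt : D j - C j < 1 := by linarith [hbε j]
  have hzeq : (τ - σ) * (D j - C j) = z := by
    rw [← hz, hM, hN]
    simp only [Pi.add_apply, Pi.smul_apply, Pi.sub_apply, smul_eq_mul]
    ring
  have habs : |τ - σ| ≤ 1 := abs_le.mpr ⟨by linarith [hσ.2, hτ.1], by linarith [hτ.2, hσ.1]⟩
  have hzlt : |(z : ℝ)| < 1 := by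
    rw [← hzeq, abs_mul, abs_of_pos hpos]
    exact (mul_le_of_le_one_left hpos.le habs).trans_lt hlt
  have hz0 : z = 0 := Int.abs_lt_one_iff.mp (by exact_mod_cast hzlt)
  rw [hz0, Int.cast_zero] at hzeq
  have hτσ : τ = σ := sub_eq_zero.mp ((mul_eq_zero.mp hzeq).resolve_right hpos.ne')
  rw [hM, hN, hτσ]
end
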